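/- Let G=(L,R;E) be a bipartite graph and let K⊆L be a set such that no identifiable ℓ-subgraph of G contains a vertex of K. Let G'=G[L\K, R\N(K)] be the ℓ-subgraph of G induced by L\K. Then a set J⊆L induces an identifiable ℓ-subgraph of G if and only if J⊆L\K and J induces an identifiable ℓ-subgraph of G'; in particular, G has an identifiable ℓ-subgraph if and only if G' does. -/

import Mathlib

open Finset

/-- A (bipartitioned) bipartite graph on a finite ambient vertex type `V`:
two disjoint finite vertex sets `L` and `R`, and an adjacency relation
(oriented from `L` to `R`) all of whose edges join a vertex of `L`
to a vertex of `R`. -/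
structure BipGraph (V : Type*) [DecidableEq V] [Fintype V] where
  L : Finset V
  R : Finset V
  disj : Disjoint L R
  adj : V → V → Bool
  adj_mem : ∀ u v, adj u v = true → u ∈ L ∧ v ∈ R

namespace BipGraph

variable {V : Type*} [DecidableEq V] [Fintype V]

/-- `N(X)`: the set of vertices of `R` having a neighbor in `X`. -/
def nbhd (G : BipGraph V) (X : Finset V) : Finset V :=
  G.R.filter (fun r => ∃ x ∈ X, G.adj x r = true)

/-- A matching of `A` into `S`: an injective assignment matching every vertex
of `A` to an adjacent vertex of `S`. -/
def HasMatchingInto (G : BipGraph V) (A S : Finset V) : Prop :=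
  ∃ f : V → V, Set.InjOn f ↑A ∧ ∀ a ∈ A, f a ∈ S ∧ G.adj a (f a) = true

/-- `G = (L,R;E)` is identifiable if `E ≠ ∅` and for every `v ∈ L` there is a
matching (necessarily of cardinality `|L| - 1`) of `L \ {v}` into `R \ N(v)`. -/
def Identifiable (G : BipGraph V) : Prop :=
  (∃ u v, G.adj u v = true) ∧
    ∀ v ∈ G.L, G.HasMatchingInto (G.L.erase v) (G.R \ G.nbhd {v})

/-- The ℓ-subgraph of `G` induced by `J ⊆ L`: the induced subgraph
`G[J, R \ N(L \ J)]`. -/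
def lSub (G : BipGraph V) (J : Finset V) : BipGraph V where
  L := J ∩ G.L
  R := G.R \ G.nbhd (G.L \ J)
  disj := G.disj.mono inter_subset_right sdiff_subset
  adj := fun u v =>
    decide (u ∈ J ∩ G.L) && decide (v ∈ G.R \ G.nbhd (G.L \ J)) && G.adj u v
  adj_mem := by
    intro u v h
    simp only [Bool.and_eq_true, decide_eq_true_eq] at h
    exact ⟨h.1.1, h.1.2⟩

end BipGraph

namespace BipGraph

variable {V : Type*} [DecidableEq V] [Fintype V]

theorem ext_of_eq {G H : BipGraph V} (hL : G.L = H.L) (hR : G.R = H.R)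
    (hadj : G.adj = H.adj) : G = H := by
  cases G
  cases H
  simp_all

theorem mem_lSub_R {G : BipGraph V} {J : Finset V} {v : V} :
    v ∈ (G.lSub J).R ↔ v ∈ G.R ∧ ∀ x ∈ G.L, G.adj x v = true → x ∈ J := by
  simp only [lSub, nbhd, mem_sdiff, mem_filter]
  grind

theorem lSub_adj_iff {G : BipGraph V} {J : Finset V} {u v : V} :
    (G.lSub J).adj u v = true ↔
      u ∈ (G.lSub J).L ∧ v ∈ (G.lSub J).R ∧ G.adj u v = true := by
  simp [lSub, and_assoc]

/-- Taking ℓ-subgraphs is transitive. -/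
theorem lSub_lSub (G : BipGraph V) {A J : Finset V} (h : J ⊆ A) :
    (G.lSub A).lSub J = G.lSub J := by
  have hL : ((G.lSub A).lSub J).L = (G.lSub J).L := by
    ext u
    simp only [lSub, mem_inter]
    grind
  have hR : ((G.lSub A).lSub J).R = (G.lSub J).R := by
    ext v
    have hA : ∀ x, x ∈ (G.lSub A).L ↔ x ∈ A ∧ x ∈ G.L := fun x => mem_inter
    simp only [mem_lSub_R, lSub_adj_iff, hA]
    grind
  refine ext_of_eq hL hR ?_
  funext u v
  rw [Bool.eq_iff_iff, lSub_adj_iff, lSub_adj_iff, lSub_adj_iff, hL, hR, mem_lSub_R]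
  have hu : u ∈ (G.lSub J).L ↔ u ∈ J ∧ u ∈ G.L := mem_inter
  have hA : u ∈ (G.lSub A).L ↔ u ∈ A ∧ u ∈ G.L := mem_inter
  simp only [mem_lSub_R, hu, hA]
  grind

end BipGraph


/-- Let `K ⊆ L` be a set such that no identifiable ℓ-subgraph of `G` contains a
vertex of `K`, and let `G' = G[L \ K, R \ N(K)]` be the ℓ-subgraph of `G`
induced by `L \ K`. Then `J ⊆ L` induces an identifiable ℓ-subgraph of `G` iff
`J ⊆ L \ K` and `J` induces an identifiable ℓ-subgraph of `G'`; in particular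
`G` has an identifiable ℓ-subgraph iff `G'` does. -/
theorem stmt5 {V : Type*} [DecidableEq V] [Fintype V] (G : BipGraph V)
    (K : Finset V) (hK : K ⊆ G.L)
    (havoid : ∀ J ⊆ G.L, (G.lSub J).Identifiable → J ∩ K = ∅) :
    (∀ J ⊆ G.L,
      ((G.lSub J).Identifiable ↔
        J ⊆ G.L \ K ∧ ((G.lSub (G.L \ K)).lSub J).Identifiable)) ∧
    ((∃ J ⊆ G.L, (G.lSub J).Identifiable) ↔
      ∃ J ⊆ (G.lSub (G.L \ K)).L, ((G.lSub (G.L \ K)).lSub J).Identifiable) := by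
  have main : ∀ J ⊆ G.L, ((G.lSub J).Identifiable ↔
      J ⊆ G.L \ K ∧ ((G.lSub (G.L \ K)).lSub J).Identifiable) := by
    intro J hJ
    constructor
    · intro h
      have hJK : J ⊆ G.L \ K :=
        subset_sdiff.2 ⟨hJ, disjoint_iff_inter_eq_empty.2 (havoid J hJ h)⟩
      exact ⟨hJK, by rwa [G.lSub_lSub hJK]⟩
    · rintro ⟨hJK, h⟩
      rwa [G.lSub_lSub hJK] at h
  have hL : (G.lSub (G.L \ K)).L = G.L \ K := inter_eq_left.2 sdiff_subset
  refine ⟨main, ?_⟩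
  rw [hL]
  constructor
  · rintro ⟨J, hJ, h⟩
    exact ⟨J, (main J hJ).1 h⟩
  · rintro ⟨J, hJK, h⟩
    have hJ : J ⊆ G.L := hJK.trans sdiff_subset
    exact ⟨J, hJ, (main J hJ).2 ⟨hJK, h⟩⟩
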